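/- For every t = 0,…,T−2, every grid point z_k ∈ Z_θ and every x with z_{k−1} < x ≤ z_k, one has ε_t(x) ≤ ε̄_t(z_k). -/

import Mathlib

open MeasureTheory Filter Set

noncomputable def rr (θ ξ : ℝ) : ℤ := ⌈ξ / θ⌉ - 1

lemma rr_meas (θ : ℝ) : Measurable (rr θ) := by
  unfold rr
  exact (Int.measurable_ceil.comp (measurable_id.div_const θ)).sub_const 1

lemma rr_lo {θ ξ : ℝ} (hθ : 0 < θ) (hξ : 0 ≤ ξ) : -1 ≤ rr θ ξ := by
  unfold rr
  have : 0 ≤ ⌈ξ / θ⌉ := Int.ceil_nonneg (by positivity)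
  omega

lemma rr_lt {θ ξ : ℝ} (hθ : 0 < θ) : (rr θ ξ : ℝ) * θ < ξ := by
  unfold rr
  have := Int.ceil_lt_add_one (ξ / θ)
  rw [← lt_div_iff₀ hθ]; push_cast; linarith

lemma rr_ge {θ ξ : ℝ} (hθ : 0 < θ) : ξ ≤ (rr θ ξ : ℝ) * θ + θ := by
  unfold rr
  have := Int.le_ceil (ξ / θ)
  rw [div_le_iff₀ hθ] at this; push_cast; linarith

lemma ae_nonneg' {ν : Measure ℝ} (hpos : ν (Set.Iio 0) = 0) : ∀ᵐ ξ ∂ν, 0 ≤ ξ := by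
  rw [ae_iff]; convert hpos using 2; ext; simp

lemma rr_int {ν : Measure ℝ} [IsProbabilityMeasure ν] (hpos : ν (Set.Iio 0) = 0) {θ : ℝ}
    (hθ : 0 < θ) (g : ℤ → ℝ) (M : ℝ) (hg : ∀ n, -1 ≤ n → |g n| ≤ M) :
    Integrable (fun ξ => g (rr θ ξ)) ν := by
  refine Integrable.of_bound ((measurable_from_top (f := g)).comp (rr_meas θ)).aestronglyMeasurable M ?_
  filter_upwards [ae_nonneg' hpos] with ξ hξ
  exact hg _ (rr_lo hθ hξ)

lemma rr_hasSum {ν : Measure ℝ} [IsProbabilityMeasure ν] (hpos : ν (Set.Iio 0) = 0) {θ : ℝ}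
    (hθ : 0 < θ) (f : ℤ → ℝ)
    (hf : ∀ n : ℤ, f n = (ν (Set.Iic (((n : ℝ) + 1) * θ))).toReal - (ν (Set.Iic ((n : ℝ) * θ))).toReal)
    (g : ℤ → ℝ) (M : ℝ) (hg : ∀ n, -1 ≤ n → |g n| ≤ M) :
    HasSum (fun n : ℕ => g ((n : ℤ) - 1) * f ((n : ℤ) - 1)) (∫ ξ, g (rr θ ξ) ∂ν) := by
  have hm : ∀ n : ℕ, MeasurableSet {ξ : ℝ | (rr θ ξ + 1).toNat = n} := fun n =>
    ((measurable_from_top (f := fun k : ℤ => (k + 1).toNat)).comp (rr_meas θ)) (measurableSet_singleton n)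
  have hU : (⋃ n : ℕ, {ξ : ℝ | (rr θ ξ + 1).toNat = n}) = univ := by
    ext; simp
  have h := hasSum_integral_iUnion (μ := ν) (f := fun ξ => g (rr θ ξ)) hm
    (by intro i j hij; rw [Function.onFun, Set.disjoint_left]; intro a ha hb; exact hij (ha.symm.trans hb))
    (by rw [hU]; exact (rr_int hpos hθ g M hg).integrableOn)
  rw [hU, setIntegral_univ] at h
  suffices hs : (fun n : ℕ => g ((n : ℤ) - 1) * f ((n : ℤ) - 1))
      = fun n : ℕ => ∫ ξ in {ξ : ℝ | (rr θ ξ + 1).toNat = n}, g (rr θ ξ) ∂ν by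
    rw [hs]; exact h
  funext n
  have e1 : ∫ ξ in {ξ : ℝ | (rr θ ξ + 1).toNat = n}, g (rr θ ξ) ∂ν
      = ∫ ξ in {ξ : ℝ | (rr θ ξ + 1).toNat = n}, g ((n : ℤ) - 1) ∂ν := by
    apply setIntegral_congr_ae (hm n)
    filter_upwards [ae_nonneg' hpos] with ξ hξ h1
    have := rr_lo hθ hξ
    change (rr θ ξ + 1).toNat = n at h1
    congr 1; omega
  rw [e1, setIntegral_const, smul_eq_mul, mul_comm, hf]
  congr 1
  have e2 : {ξ : ℝ | (rr θ ξ + 1).toNat = n} =ᵐ[ν] (Set.Iic ((((((n:ℤ)-1 : ℤ)) : ℝ) + 1) * θ) \ Set.Iic (((((n:ℤ)-1 : ℤ)) : ℝ) * θ) : Set ℝ) := by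
    filter_upwards [ae_nonneg' hpos] with ξ hξ
    have h0 := rr_lo hθ hξ
    apply propext
    change (rr θ ξ + 1).toNat = n ↔ (ξ ≤ _ ∧ ¬ ξ ≤ _)
    have h1 := @rr_lt θ ξ hθ
    have h2 := @rr_ge θ ξ hθ
    constructor
    · intro h
      have : ((n:ℤ)-1 : ℤ) = rr θ ξ := by omega
      rw [this]; constructor <;> linarith
    · rintro ⟨h3, h4⟩
      push Not at h4
      have h5 : (rr θ ξ : ℝ) * θ < ((((n:ℤ)-1 : ℤ) : ℝ) + 1) * θ := by linarith
      have h6 : ((((n:ℤ)-1 : ℤ)) : ℝ) * θ < ((rr θ ξ : ℝ) + 1) * θ := by linarith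
      have h5' := lt_of_mul_lt_mul_right h5 hθ.le
      have h6' := lt_of_mul_lt_mul_right h6 hθ.le
      have h5'' : rr θ ξ < (n:ℤ) - 1 + 1 := by exact_mod_cast h5'
      have h6'' : (n:ℤ) - 1 < rr θ ξ + 1 := by exact_mod_cast h6'
      omega
  rw [measureReal_congr e2, measureReal_diff _ measurableSet_Iic]
  · rfl
  · apply Iic_subset_Iic.2; nlinarith

structure Lev (θ s : ℝ) (V : ℝ → ℝ) (Φ : ℤ → ℝ) : Prop where
  nn : ∀ j, 0 ≤ Φ j
  mono : ∀ i j, i ≤ j → Φ i ≤ Φ j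
  zero : ∀ j : ℤ, (j : ℝ) * θ < s → Φ j = 0
  const : ∃ c, ∀ y < s, V y = c
  meas : Measurable V
  bdd : ∀ B, ∃ M, ∀ y ≤ B, |V y| ≤ M
  a : ∀ (j : ℤ) v u, ((j : ℝ) - 1) * θ ≤ v → v ≤ u → u < j * θ → |V v - V u| ≤ Φ j * ((u - v) / θ)
  b : ∀ j : ℤ, |V (((j : ℝ) - 1) * θ) - V (j * θ)| ≤ Φ j
  b' : ∀ (j : ℤ) v, ((j : ℝ) - 1) * θ ≤ v → v < j * θ → V v - V (j * θ) ≤ Φ j * (1 + (j * θ - v) / θ)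

lemma ex_cell {θ : ℝ} (hθ : 0 < θ) (u : ℝ) : ∃ j : ℤ, ((j : ℝ) - 1) * θ ≤ u ∧ u < j * θ := by
  refine ⟨⌊u / θ⌋ + 1, ?_, ?_⟩
  · have := Int.floor_le (u / θ)
    rw [le_div_iff₀ hθ] at this; push_cast; linarith
  · have := Int.lt_floor_add_one (u / θ)
    rw [div_lt_iff₀ hθ] at this; push_cast; linarith

lemma int_lt {θ : ℝ} (hθ : 0 < θ) {i j : ℤ} (h : (i : ℝ) * θ < j * θ) : i < j := by
  exact_mod_cast lt_of_mul_lt_mul_right h hθ.le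
lemma int_le {θ : ℝ} (hθ : 0 < θ) {i j : ℤ} (h : (i : ℝ) * θ ≤ j * θ) : i ≤ j := by
  exact_mod_cast le_of_mul_le_mul_right h hθ

lemma Lev.c {θ s : ℝ} {V : ℝ → ℝ} {Φ : ℤ → ℝ} (L : Lev θ s V Φ) (hθ : 0 < θ) {v u : ℝ} {j : ℤ}
    (h1 : v ≤ u) (h2 : u - θ ≤ v) (h3 : u ≤ j * θ) : V v - V u ≤ 2 * Φ j := by
  obtain ⟨i, hi1, hi2⟩ := ex_cell hθ u
  have hij : i - 1 ≤ j := by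
    apply int_le hθ; push_cast; linarith
  have nj := L.nn j
  have d1 : (u - v) / θ ≤ 1 := by rw [div_le_one hθ]; linarith
  have d0 : 0 ≤ (u - v) / θ := div_nonneg (by linarith) hθ.le
  by_cases hv : ((i : ℝ) - 1) * θ ≤ v
  · rcases eq_or_lt_of_le hi1 with h | h
    · have : v = u := by linarith
      rw [this]; linarith
    have hij' : i ≤ j := by
      have : i - 1 < j := by apply int_lt hθ; push_cast; linarith
      omega
    have := (le_abs_self _).trans (L.a i v u hv h1 hi2)
    have m := L.mono i j hij'
    nlinarith [L.nn i]
  · push Not at hv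
    have hb := L.b' (i - 1) v (by push_cast; nlinarith) (by push_cast; linarith)
    have m' := L.mono (i-1) j hij
    push_cast at hb
    rcases eq_or_lt_of_le hi1 with h | h
    · rw [h] at hb
      nlinarith [L.nn (i-1)]
    have hij' : i ≤ j := by
      have : i - 1 < j := by apply int_lt hθ; push_cast; linarith
      omega
    have ha := (le_abs_self _).trans (L.a i _ u le_rfl hi1 hi2)
    have m := L.mono i j hij'
    have e : (u - ((i:ℝ) - 1) * θ) / θ + ((((i:ℝ) - 1) * θ - v) / θ) = (u - v) / θ := by ring
    have p1 : 0 ≤ (u - ((i:ℝ) - 1) * θ) / θ := div_nonneg (by linarith) hθ.le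
    have p2 : 0 ≤ ((((i:ℝ) - 1) * θ - v) / θ) := div_nonneg (by linarith) hθ.le
    have q1 := mul_le_mul_of_nonneg_right m p1
    have q2 := mul_le_mul_of_nonneg_right m' (by linarith : 0 ≤ 1 + ((((i:ℝ) - 1) * θ - v) / θ))
    nlinarith

section
variable {ν : Measure ℝ} [IsProbabilityMeasure ν] {θ s : ℝ} {V : ℝ → ℝ} {Φ : ℤ → ℝ}

lemma Lev.intV (L : Lev θ s V Φ) (hpos : ν (Set.Iio 0) = 0) (hθ : 0 < θ) (y : ℝ) :
    Integrable (fun ξ => V (y - rr θ ξ * θ)) ν := by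
  obtain ⟨M, hM⟩ := L.bdd (y + θ)
  refine rr_int hpos hθ (fun n : ℤ => V (y - n * θ)) M (fun n hn => hM _ ?_)
  have : (-1 : ℝ) ≤ n := by exact_mod_cast hn
  nlinarith

lemma Lev.bddΦ (L : Lev θ s V Φ) (j n : ℤ) (hn : -1 ≤ n) : |Φ (j - n)| ≤ Φ (j + 1) := by
  rw [abs_of_nonneg (L.nn _)]; exact L.mono _ _ (by omega)

lemma Lev.intΦ (L : Lev θ s V Φ) (hpos : ν (Set.Iio 0) = 0) (hθ : 0 < θ) (j : ℤ) :
    Integrable (fun ξ => Φ (j - rr θ ξ)) ν :=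
  rr_int hpos hθ (fun n : ℤ => Φ (j - n)) _ (L.bddΦ j)

lemma Lev.A (L : Lev θ s V Φ) (hpos : ν (Set.Iio 0) = 0) (hθ : 0 < θ) {x : ℝ} {j : ℤ}
    (hx : x ≤ j * θ) :
    (∫ ξ, V (x - ξ) ∂ν) - (∫ ξ, V (x - rr θ ξ * θ) ∂ν) ≤ 2 * ∫ ξ, Φ (j - rr θ ξ) ∂ν := by
  have i1 : Integrable (fun ξ => V (x - ξ)) ν := by
    obtain ⟨M, hM⟩ := L.bdd x
    refine Integrable.of_bound (L.meas.comp (measurable_const.sub measurable_id)).aestronglyMeasurable M ?_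
    filter_upwards [ae_nonneg' hpos] with ξ hξ
    exact hM _ (by simpa using hξ)
  rw [← integral_sub i1 (L.intV hpos hθ x), ← integral_const_mul]
  refine integral_mono (i1.sub (L.intV hpos hθ x)) ((L.intΦ hpos hθ j).const_mul 2) (fun ξ => ?_)
  have h1 := @rr_lt θ ξ hθ
  have h2 := @rr_ge θ ξ hθ
  apply L.c hθ <;> try linarith
  push_cast; linarith

/-- difference of the smoothed value function -/
lemma int_diff (L : Lev θ s V Φ) (hpos : ν (Set.Iio 0) = 0) (hθ : 0 < θ) (y y' : ℝ) (j : ℤ) (c : ℝ)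
    (h : ∀ n : ℤ, V (y - n * θ) - V (y' - n * θ) ≤ Φ (j - n) * c) :
    (∫ ξ, V (y - rr θ ξ * θ) ∂ν) - (∫ ξ, V (y' - rr θ ξ * θ) ∂ν) ≤ (∫ ξ, Φ (j - rr θ ξ) ∂ν) * c := by
  rw [← integral_sub (L.intV hpos hθ y) (L.intV hpos hθ y'), ← integral_mul_const]
  exact integral_mono ((L.intV hpos hθ y).sub (L.intV hpos hθ y')) ((L.intΦ hpos hθ j).mul_const c) (fun ξ => h _)

lemma int_absdiff (L : Lev θ s V Φ) (hpos : ν (Set.Iio 0) = 0) (hθ : 0 < θ) (y y' : ℝ) (j : ℤ) (c : ℝ)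
    (h : ∀ n : ℤ, |V (y - n * θ) - V (y' - n * θ)| ≤ Φ (j - n) * c) :
    |(∫ ξ, V (y - rr θ ξ * θ) ∂ν) - (∫ ξ, V (y' - rr θ ξ * θ) ∂ν)| ≤ (∫ ξ, Φ (j - rr θ ξ) ∂ν) * c := by
  rw [abs_sub_le_iff]
  exact ⟨int_diff L hpos hθ y y' j c fun n => (le_abs_self _).trans (h n),
    int_diff L hpos hθ y' y j c fun n => (le_abs_self _).trans (abs_sub_comm (V (y - n * θ)) _ ▸ h n)⟩

lemma Lev.step (L : Lev θ s V Φ) (hpos : ν (Set.Iio 0) = 0) (hθ : 0 < θ)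
    {α γ : ℝ} (hα : 0 < α) (hγ : 0 ≤ γ) {C H : ℝ → ℝ} (hC : ∀ x y, |C x - C y| ≤ γ * |x - y|)
    (hH : ∀ y, H y = C y + α * ∫ ξ, V (y - rr θ ξ * θ) ∂ν)
    {P : ℤ → ℝ} (hP : ∀ j, P j = γ * θ + α * ∫ ξ, Φ (j - rr θ ξ) ∂ν)
    {σ : ℤ} {V2 : ℝ → ℝ} {Φ2 : ℤ → ℝ} {c : ℝ}
    (hV2 : ∀ y, V2 y = if y < σ * θ then c else H y)
    (hΦ2 : ∀ j, Φ2 j = if j < σ then 0 else P j)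
    (hj0 : H (σ * θ) ≤ c) (hj1 : c ≤ H (((σ:ℝ) - 1) * θ) ∨ c = H (σ * θ)) :
    Lev θ (σ * θ) V2 Φ2 := by
  have nnI : ∀ j, 0 ≤ ∫ ξ, Φ (j - rr θ ξ) ∂ν := fun j => integral_nonneg fun ξ => L.nn _
  have nnP : ∀ j, 0 ≤ P j := fun j => by
    rw [hP]; have := nnI j; positivity
  have monoP : ∀ i j, i ≤ j → P i ≤ P j := fun i j hij => by
    rw [hP, hP]
    have : ∫ ξ, Φ (i - rr θ ξ) ∂ν ≤ ∫ ξ, Φ (j - rr θ ξ) ∂ν :=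
      integral_mono (L.intΦ hpos hθ i) (L.intΦ hpos hθ j) (fun ξ => L.mono _ _ (by omega))
    nlinarith
  have measH : Measurable H := by
    have : H = fun y => C y + α * ∫ ξ, V (y - rr θ ξ * θ) ∂ν := funext hH
    rw [this]
    have hCm : Measurable C := by
      have : LipschitzWith ⟨γ, hγ⟩ C := LipschitzWith.of_dist_le_mul fun x y => by
        rw [Real.dist_eq, Real.dist_eq]; exact hC x y
      exact this.continuous.measurable
    refine hCm.add (Measurable.const_mul ?_ α)
    refine (StronglyMeasurable.integral_prod_right (ν := ν) (f := fun (y ξ : ℝ) => V (y - rr θ ξ * θ)) ?_).measurable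
    refine (L.meas.comp (measurable_fst.sub (Measurable.mul_const ?_ θ))).stronglyMeasurable
    exact (measurable_from_top (f := fun n : ℤ => (n : ℝ))).comp ((rr_meas θ).comp measurable_snd)
  have bddH : ∀ B, ∃ M, ∀ y, σ * θ ≤ y → y ≤ B → |H y| ≤ M := fun B => by
    obtain ⟨M, hM⟩ := L.bdd (B + θ)
    refine ⟨|C (σ * θ)| + γ * (B - σ * θ) + α * M, fun y h1 h2 => ?_⟩
    have b1 : |∫ ξ, V (y - rr θ ξ * θ) ∂ν| ≤ M := by
      have := norm_integral_le_of_norm_le_const (μ := ν) (f := fun ξ => V (y - rr θ ξ * θ)) (C := M) (by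
        filter_upwards [ae_nonneg' hpos] with ξ hξ
        apply hM
        have : (-1 : ℝ) ≤ rr θ ξ := by exact_mod_cast rr_lo hθ hξ
        nlinarith)
      simpa using this
    have b2 := hC y (σ * θ)
    rw [abs_of_nonneg (by linarith : 0 ≤ y - σ * θ)] at b2
    have b3 : |C y| ≤ |C (σ * θ)| + |C y - C (σ * θ)| := by
      have := abs_add_le (C (σ * θ)) (C y - C (σ * θ)); simpa using this
    rw [hH]
    refine (abs_add_le _ _).trans ?_
    rw [abs_mul, abs_of_pos hα]
    have : γ * (y - σ * θ) ≤ γ * (B - σ * θ) := mul_le_mul_of_nonneg_left (by linarith) hγ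
    nlinarith
  have aH : ∀ (j : ℤ) v u, ((j : ℝ) - 1) * θ ≤ v → v ≤ u → u < j * θ →
      |H v - H u| ≤ P j * ((u - v) / θ) := fun j v u h1 h2 h3 => by
    have hi := int_absdiff (ν := ν) L hpos hθ v u j ((u - v) / θ) (fun n => by
      have := L.a (j - n) (v - n * θ) (u - n * θ) (by push_cast; linarith) (by linarith) (by push_cast; linarith)
      rwa [sub_sub_sub_cancel_right] at this)
    have hc := hC v u
    rw [abs_sub_comm v u, abs_of_nonneg (by linarith : 0 ≤ u - v)] at hc
    rw [hH, hH, hP, add_sub_add_comm, ← mul_sub]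
    refine (abs_add_le _ _).trans ?_
    rw [abs_mul, abs_of_pos hα, add_mul, mul_assoc γ, mul_div_cancel₀ _ hθ.ne', mul_assoc α]
    nlinarith
  have bH : ∀ j : ℤ, |H (((j : ℝ) - 1) * θ) - H (j * θ)| ≤ P j := fun j => by
    have hi := int_absdiff (ν := ν) L hpos hθ (((j : ℝ) - 1) * θ) (j * θ) j 1 (fun n => by
      have := L.b (j - n)
      push_cast at this
      rw [mul_one]; convert this using 4 <;> ring)
    have hc := hC (((j : ℝ) - 1) * θ) (j * θ)
    rw [show ((j : ℝ) - 1) * θ - j * θ = -θ by ring, abs_neg, abs_of_pos hθ] at hc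
    rw [hH, hH, hP, add_sub_add_comm, ← mul_sub]
    refine (abs_add_le _ _).trans ?_
    rw [abs_mul, abs_of_pos hα]
    nlinarith
  have b'H : ∀ (j : ℤ) v, ((j : ℝ) - 1) * θ ≤ v → v < j * θ →
      H v - H (j * θ) ≤ P j * (1 + (j * θ - v) / θ) := fun j v h1 h2 => by
    have hi := int_diff (ν := ν) L hpos hθ v (j * θ) j (1 + (j * θ - v) / θ) (fun n => by
      have := L.b' (j - n) (v - n * θ) (by push_cast; linarith) (by push_cast; linarith)
      push_cast at this
      convert this using 3 <;> ring_nf)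
    have hc := (le_abs_self _).trans (hC v (j * θ))
    rw [abs_sub_comm, abs_of_nonneg (by linarith : 0 ≤ j * θ - v)] at hc
    rw [hH, hH, hP, add_sub_add_comm, ← mul_sub, add_mul, mul_assoc α]
    have e : γ * θ * (1 + (j * θ - v) / θ) = γ * θ + γ * (j * θ - v) := by field_simp
    have : 0 ≤ γ * θ := by positivity
    rw [e]
    nlinarith
  have jump : c - H (σ * θ) ≤ P σ := by
    rcases hj1 with h | h
    · have := (le_abs_self _).trans (bH σ); linarith
    · have := nnP σ; linarith
  have lt_cases : ∀ {i j : ℤ}, i < j → (i : ℝ) * θ ≤ ((j : ℝ) - 1) * θ := fun {i j} h => by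
    have : (i : ℝ) ≤ (j : ℝ) - 1 := by
      have : i ≤ j - 1 := by omega
      exact_mod_cast this
    nlinarith
  have nn2 : ∀ j, 0 ≤ Φ2 j := fun j => by rw [hΦ2]; split_ifs <;> simp [nnP]
  refine ⟨nn2, ?_, ?_, ⟨c, fun y hy => by rw [hV2, if_pos hy]⟩, ?_, ?_, ?_, ?_, ?_⟩
  · intro i j hij
    by_cases hi : i < σ
    · rw [hΦ2 i, if_pos hi]; exact nn2 j
    · rw [hΦ2, hΦ2, if_neg hi, if_neg (by omega)]; exact monoP i j hij
  · intro j hj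
    rw [hΦ2, if_pos (int_lt hθ hj)]
  · have : V2 = fun y => if y < σ * θ then c else H y := funext hV2
    rw [this]
    exact Measurable.ite measurableSet_Iio measurable_const measH
  · intro B
    obtain ⟨M, hM⟩ := bddH B
    refine ⟨max M |c|, fun y hy => ?_⟩
    rw [hV2]; split_ifs with h
    · exact le_max_right _ _
    · exact (hM y (not_lt.1 h) hy).trans (le_max_left _ _)
  · intro j v u h1 h2 h3
    by_cases h : σ < j
    · have := lt_cases h
      rw [hV2, hV2, hΦ2, if_neg (by linarith), if_neg (by linarith), if_neg (by omega)]
      exact aH j v u h1 h2 h3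
    · have : (j : ℝ) * θ ≤ σ * θ := by
        have : (j : ℝ) ≤ σ := by exact_mod_cast not_lt.1 h
        nlinarith
      rw [hV2, hV2, if_pos (by linarith), if_pos (by linarith), sub_self, abs_zero]
      exact mul_nonneg (nn2 j) (div_nonneg (by linarith) hθ.le)
  · intro j
    rcases lt_trichotomy j σ with h | h | h
    · have := lt_cases h
      rw [hV2, hV2, if_pos (by linarith), if_pos (by linarith), sub_self, abs_zero]
      exact nn2 j
    · subst h
      rw [hV2, hV2, if_pos (by linarith), if_neg (by linarith), hΦ2, if_neg (by omega), abs_of_nonneg (by linarith)]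
      exact jump
    · have := lt_cases h
      rw [hV2, hV2, hΦ2, if_neg (by linarith), if_neg (by linarith), if_neg (by omega)]
      exact bH j
  · intro j v h1 h2
    have p0 : 0 ≤ (j * θ - v) / θ := div_nonneg (by linarith) hθ.le
    rcases lt_trichotomy j σ with h | h | h
    · have := lt_cases h
      rw [hV2, hV2, if_pos (by linarith), if_pos (by linarith), sub_self]
      exact mul_nonneg (nn2 j) (by linarith)
    · subst h
      rw [hV2, hV2, if_pos (by linarith), if_neg (by linarith), hΦ2, if_neg (by omega)]
      nlinarith [nnP j]
    · have := lt_cases h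
      rw [hV2, hV2, hΦ2, if_neg (by linarith), if_neg (by linarith), if_neg (by omega)]
      exact b'H j v h1 h2
end

lemma Lev.base {θ s γ c : ℝ} (hθ : 0 < θ) (hγ : 0 ≤ γ) {C V : ℝ → ℝ} {Φ : ℤ → ℝ}
    (hC : ∀ x y, |C x - C y| ≤ γ * |x - y|) (hc : C s = c)
    (hV : ∀ y, V y = if y < s then c else C y)
    (hΦ : ∀ j : ℤ, Φ j = if (j : ℝ) * θ < s then 0 else γ * θ) : Lev θ s V Φ := by
  have hV' : ∀ y, V y = C (max y s) := fun y => by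
    rw [hV]; split_ifs with h
    · rw [max_eq_right h.le, hc]
    · rw [max_eq_left (not_lt.1 h)]
  have hL : ∀ v u, v ≤ u → |V v - V u| ≤ γ * (u - v) := fun v u h => by
    rw [hV', hV']
    refine (hC _ _).trans (mul_le_mul_of_nonneg_left ?_ hγ)
    refine (abs_max_sub_max_le_abs v u s).trans ?_
    rw [abs_sub_comm, abs_of_nonneg (by linarith)]
  have nn : ∀ j, 0 ≤ Φ j := fun j => by rw [hΦ]; split_ifs <;> positivity
  have key : ∀ (j : ℤ) v u, v ≤ u → u ≤ j * θ → |V v - V u| ≤ Φ j * ((u - v) / θ) := fun j v u h1 h2 => by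
    by_cases h : (j : ℝ) * θ < s
    · rw [hV, hV, if_pos (by linarith), if_pos (by linarith), sub_self, abs_zero]
      exact mul_nonneg (nn j) (div_nonneg (by linarith) hθ.le)
    · rw [hΦ, if_neg h, mul_assoc, mul_div_cancel₀ _ hθ.ne']
      exact hL v u h1
  refine ⟨nn, ?_, fun j h => by rw [hΦ, if_pos h], ⟨c, fun y hy => by rw [hV, if_pos hy]⟩, ?_, ?_, ?_, ?_, ?_⟩
  · intro i j hij
    have : (i : ℝ) * θ ≤ j * θ := by
      have : (i : ℝ) ≤ j := by exact_mod_cast hij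
      nlinarith
    by_cases hi : (i : ℝ) * θ < s
    · rw [hΦ i, if_pos hi]; exact nn j
    · rw [hΦ, hΦ, if_neg hi, if_neg (by linarith)]
  · have : LipschitzWith ⟨γ, hγ⟩ V := LipschitzWith.of_dist_le_mul fun x y => by
      rw [Real.dist_eq, Real.dist_eq]
      rcases le_total x y with h | h
      · rw [abs_sub_comm x y, abs_of_nonneg (by linarith : 0 ≤ y - x)]; exact hL x y h
      · rw [abs_sub_comm, abs_of_nonneg (by linarith : 0 ≤ x - y)]; exact hL y x h
    exact this.continuous.measurable
  · intro B
    refine ⟨|c| + γ * (max B s - s), fun y hy => ?_⟩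
    rw [hV', ← hc]
    have h1 := hC (max y s) s
    rw [abs_of_nonneg (by linarith [le_max_right y s] : 0 ≤ max y s - s)] at h1
    have h2 := abs_add_le (C s) (C (max y s) - C s)
    rw [add_sub_cancel] at h2
    have : γ * (max y s - s) ≤ γ * (max B s - s) :=
      mul_le_mul_of_nonneg_left (by linarith [max_le_max_right s hy]) hγ
    linarith
  · intro j v u h1 h2 h3
    exact key j v u h2 h3.le
  · intro j
    have := key j (((j : ℝ) - 1) * θ) (j * θ) (by nlinarith) le_rfl
    rwa [show (j : ℝ) * θ - ((j : ℝ) - 1) * θ = θ by ring, div_self hθ.ne', mul_one] at this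
  · intro j v h1 h2
    have := (le_abs_self _).trans (key j v _ h2.le le_rfl)
    nlinarith [nn j]

lemma Lev.A1 {ν : Measure ℝ} [IsProbabilityMeasure ν] {θ s : ℝ} {V : ℝ → ℝ} {Φ : ℤ → ℝ}
    (L : Lev θ s V Φ) (hpos : ν (Set.Iio 0) = 0) (hθ : 0 < θ) {x c : ℝ}
    (h : ∀ v u, v ≤ u → u - θ ≤ v → V v - V u ≤ c) :
    (∫ ξ, V (x - ξ) ∂ν) - (∫ ξ, V (x - rr θ ξ * θ) ∂ν) ≤ c := by
  have i1 : Integrable (fun ξ => V (x - ξ)) ν := by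
    obtain ⟨M, hM⟩ := L.bdd x
    refine Integrable.of_bound (L.meas.comp (measurable_const.sub measurable_id)).aestronglyMeasurable M ?_
    filter_upwards [ae_nonneg' hpos] with ξ hξ
    exact hM _ (by simpa using hξ)
  rw [← integral_sub i1 (L.intV hpos hθ x)]
  have e : c = ∫ _, c ∂ν := by simp
  rw [e]
  refine integral_mono (i1.sub (L.intV hpos hθ x)) (integrable_const c) (fun ξ => ?_)
  have h1 := @rr_lt θ ξ hθ
  have h2 := @rr_ge θ ξ hθ
  apply h <;> linarith

lemma sum_conv (h : ℤ → ℝ) (n : ℤ) (hn : 0 ≤ n) :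
    ∑ j ∈ Finset.Icc (-1 : ℤ) (n - 1), h j = ∑ m ∈ Finset.range (n + 1).toNat, h ((m : ℤ) - 1) := by
  symm
  refine Finset.sum_nbij' (fun m => (m : ℤ) - 1) (fun j => (j + 1).toNat) ?_ ?_ ?_ ?_ ?_
  · intro a ha; simp only [Finset.mem_range, Finset.mem_Icc] at *; omega
  · intro a ha; simp only [Finset.mem_range, Finset.mem_Icc] at *; omega
  · intro a ha; simp
  · intro a ha; simp only [Finset.mem_Icc] at *; omega
  · intro a ha; rfl

lemma Lev.tsumV {ν : Measure ℝ} [IsProbabilityMeasure ν] {θ s : ℝ} {V : ℝ → ℝ} {Φ : ℤ → ℝ}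
    (L : Lev θ s V Φ) (hpos : ν (Set.Iio 0) = 0) (hθ : 0 < θ) (f : ℤ → ℝ)
    (hf : ∀ n : ℤ, f n = (ν (Set.Iic (((n : ℝ) + 1) * θ))).toReal - (ν (Set.Iic ((n : ℝ) * θ))).toReal)
    (y : ℝ) : ∑' n : ℕ, V (y - ((n : ℝ) - 1) * θ) * f ((n : ℤ) - 1) = ∫ ξ, V (y - rr θ ξ * θ) ∂ν := by
  obtain ⟨M, hM⟩ := L.bdd (y + θ)
  have := rr_hasSum hpos hθ f hf (fun n : ℤ => V (y - n * θ)) M (fun n hn => hM _ (by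
    have : (-1 : ℝ) ≤ n := by exact_mod_cast hn
    nlinarith))
  rw [← this.tsum_eq]
  push_cast
  rfl

lemma Lev.psi {ν : Measure ℝ} [IsProbabilityMeasure ν] {θ s : ℝ} {V : ℝ → ℝ} {Φ : ℤ → ℝ}
    (L : Lev θ s V Φ) (hpos : ν (Set.Iio 0) = 0) (hθ : 0 < θ) (f : ℤ → ℝ)
    (hf : ∀ n : ℤ, f n = (ν (Set.Iic (((n : ℝ) + 1) * θ))).toReal - (ν (Set.Iic ((n : ℝ) * θ))).toReal)
    (j : ℤ) (p α γ : ℝ)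
    (hA : (j : ℝ) * θ < s - θ → p = γ * θ)
    (hB : s - θ ≤ (j : ℝ) * θ → ∀ n : ℤ, ((n : ℝ) - 1) * θ ≤ j * θ - s → j * θ - s < (n : ℝ) * θ →
      p = γ * θ + α * ∑ i ∈ Finset.Icc (-1 : ℤ) (n - 1), Φ (j - i) * f i) :
    p = γ * θ + α * ∫ ξ, Φ (j - rr θ ξ) ∂ν := by
  rcases lt_or_ge ((j : ℝ) * θ) (s - θ) with h | h
  · rw [hA h, integral_eq_zero_of_ae, mul_zero, add_zero]
    filter_upwards [ae_nonneg' hpos] with ξ hξ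
    apply L.zero
    have : (-1 : ℝ) ≤ rr θ ξ := by exact_mod_cast rr_lo hθ hξ
    push_cast; nlinarith
  · obtain ⟨n, h1, h2⟩ := ex_cell hθ ((j : ℝ) * θ - s)
    rw [hB h n h1 h2]
    have hn : 0 ≤ n := by
      have : (-1 : ℤ) < n := by apply int_lt hθ; push_cast; linarith
      omega
    rw [sum_conv (fun i => Φ (j - i) * f i) n hn]
    have hs := rr_hasSum hpos hθ f hf (fun n : ℤ => Φ (j - n)) _ (L.bddΦ j)
    rw [← hs.tsum_eq, tsum_eq_sum (s := Finset.range (n + 1).toNat)]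
    intro m hm
    have hm' : n ≤ (m : ℤ) - 1 := by simp only [Finset.mem_range] at hm; omega
    have hm'' : (n : ℝ) ≤ (m : ℝ) - 1 := by exact_mod_cast hm'
    rw [L.zero _ (by push_cast; nlinarith), zero_mul]

theorem stmt18
    (T : ℕ) (hT : 2 ≤ T)
    (α : ℝ) (hα0 : 0 < α) (hα1 : α ≤ 1)
    (K : ℕ → ℝ) (hK0 : ∀ t, t < T → 0 ≤ K t)
    (hKmono : ∀ t, t + 2 ≤ T → α * K (t + 1) ≤ K t)
    (ν : ℕ → MeasureTheory.Measure ℝ)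
    (hprob : ∀ t, MeasureTheory.IsProbabilityMeasure (ν t))
    (hpos : ∀ t, ν t (Set.Iio 0) = 0)
    (F : ℕ → ℝ → ℝ) (hF : ∀ t x, F t x = (ν t (Set.Iic x)).toReal)
    (C : ℕ → ℝ → ℝ)
    (hCconv : ∀ t, t < T → ConvexOn ℝ Set.univ (C t))
    (hCcoer : ∀ t, t < T → Filter.Tendsto (C t) (Filter.cocompact ℝ) Filter.atTop)
    (θ : ℝ) (hθ : 0 < θ)
    (f : ℕ → ℤ → ℝ)
    (hf : ∀ t (n : ℤ), f t n = F t (((n : ℝ) + 1) * θ) - F t ((n : ℝ) * θ))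
    (Cm SU : ℕ → ℝ)
    (hCm : ∀ t, t < T → IsLeast {x | ∀ y, C t x ≤ C t y} (Cm t))
    (hSU : ∀ t, t < T → ∀ n0 : ℤ, (n0 : ℝ) * θ < Cm t → Cm t ≤ ((n0 : ℝ) + 1) * θ →
      IsLeast {w | (∃ m : ℤ, w = (m : ℝ) * θ) ∧ Cm t ≤ w ∧ C t ((n0 : ℝ) * θ) + K t < C t w} (SU t))
    (s S : ℕ → ℝ) (I Ibar : ℕ → ℝ)
    (hsT1a : s (T - 1) ≤ Cm (T - 1))
    (hsT1b : C (T - 1) (s (T - 1)) = C (T - 1) (Cm (T - 1)) + K (T - 1))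
    (hIbarT1 : Ibar (T - 1) = s (T - 1))
    (hI : ∀ t, t + 2 ≤ T →
      IsGreatest {w | (∃ m : ℤ, w = (m : ℝ) * θ) ∧ w < min (Ibar (t + 1) - θ) (Cm t)} (I t))
    (hIbar : ∀ t, t + 2 ≤ T →
      IsGreatest {w | (∃ m : ℤ, w = (m : ℝ) * θ) ∧ w ≤ I t ∧ C t (I t) + K t < C t w} (Ibar t - θ))
    (H V : ℕ → ℝ → ℝ)
    (hHT1 : ∀ y, H (T - 1) y = C (T - 1) y)
    (hST1 : S (T - 1) = Cm (T - 1))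
    (hV : ∀ t, t < T → ∀ y, V t y = if y < s t then H t (S t) + K t else H t y)
    (hHrec : ∀ t, t + 2 ≤ T → ∀ y,
      H t y = C t y + α * ∑' n : ℕ, V (t + 1) (y - ((n : ℝ) - 1) * θ) * f t ((n : ℤ) - 1))
    (hSdef : ∀ t, t + 2 ≤ T →
      IsGreatest {w | (∃ m : ℤ, w = (m : ℝ) * θ) ∧ I t ≤ w ∧ w ≤ SU t ∧
        ∀ u, (∃ n : ℤ, u = (n : ℝ) * θ) → I t ≤ u → u ≤ SU t → H t w ≤ H t u} (S t))
    (hsdef0 : ∀ t, t + 2 ≤ T → K t = 0 → s t = S t)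
    (hsdef1 : ∀ t, t + 2 ≤ T → 0 < K t →
      IsLeast {w | (∃ m : ℤ, w = (m : ℝ) * θ) ∧ Ibar t ≤ w ∧ w ≤ S t ∧ H t w ≤ H t (S t) + K t} (s t))
    (γ : ℕ → ℝ) (hγ : ∀ t, t < T → 0 ≤ γ t)
    (hLip : ∀ t, t < T → ∀ x y, |C t x - C t y| ≤ γ t * |x - y|)
    (psib phib : ℕ → ℝ → ℝ → ℝ)
    (hpsibT1 : ∀ x y : ℝ, psib (T - 1) x y = γ (T - 1) * x)
    (hphibT1 : ∀ x y : ℝ, phib (T - 1) x y = if y < s (T - 1) then 0 else γ (T - 1) * x)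
    (hpsibA : ∀ t, t + 2 ≤ T → ∀ x y : ℝ, y < s (t + 1) - θ → psib t x y = γ t * x)
    (hpsibB : ∀ t, t + 2 ≤ T → ∀ x y : ℝ, s (t + 1) - θ ≤ y → ∀ n : ℤ,
      ((n : ℝ) - 1) * θ ≤ y - s (t + 1) → y - s (t + 1) < (n : ℝ) * θ →
      psib t x y = γ t * x
        + α * ∑ j ∈ Finset.Icc (-1 : ℤ) (n - 1), phib (t + 1) x (y - (j : ℝ) * θ) * f t j)
    (hphib : ∀ t, t + 2 ≤ T → ∀ x y : ℝ, phib t x y =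
      if y < s t then 0 else if y - x < s t then psib t (y - s t + θ) y else psib t x y)
    (A : ℕ → ℝ → ℝ)
    (hA : ∀ t, 1 ≤ t → t < T → ∀ x, A t x =
      (∫ ξ, V t (x - ξ) ∂(ν (t - 1)))
        - ∑' n : ℕ, V t (x - ((n : ℝ) - 1) * θ) * f (t - 1) ((n : ℤ) - 1))
    (eps : ℕ → ℝ → ℝ)
    (hepsT1 : ∀ x, eps (T - 1) x = 0)
    (heps : ∀ t, t + 2 ≤ T → ∀ x, eps t x =
      if x < s t then α * A (t + 1) (S t) + α * ∫ ξ, eps (t + 1) (S t - ξ) ∂(ν t)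
      else α * A (t + 1) x + α * ∫ ξ, eps (t + 1) (x - ξ) ∂(ν t))
    (lam : ℕ → ℤ → ℕ → ℝ)
    (hlam0 : ∀ t k, lam t k 0 = (k : ℝ) * θ)
    (hlamS : ∀ t k i, lam t k (i + 1) = max (lam t k i) (S (t + i)) + θ)
    (epsb : ℕ → ℤ → ℝ)
    (hepsbT2 : ∀ k, epsb (T - 2) k = α * γ (T - 1) * θ)
    (hepsbRec : ∀ t k, t + 3 ≤ T → epsb t k =
      α ^ (T - 1 - t) * γ (T - 1) * θ
        + ∑ i ∈ Finset.range (T - 2 - t),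
            2 * α ^ i * (psib (t + i) θ (max (lam t k i) (S (t + i))) - γ (t + i) * θ))
    :
    ∀ t, t + 2 ≤ T → ∀ k : ℤ, ∀ x : ℝ, ((k : ℝ) - 1) * θ < x → x ≤ (k : ℝ) * θ →
      eps t x ≤ epsb t k := by
  have hf' : ∀ t, ∀ n : ℤ, f t n = (ν t (Set.Iic (((n : ℝ) + 1) * θ))).toReal - (ν t (Set.Iic ((n : ℝ) * θ))).toReal :=
    fun t n => by rw [hf, hF, hF]
  -- the backward induction for the value functions
  have main : ∀ d t, t + d + 1 = T →
      Lev θ (s t) (V t) (fun j : ℤ => phib t θ (j * θ)) ∧ Ibar t ≤ s t := by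
    intro d
    induction d with
    | zero =>
      intro t ht
      obtain rfl : t = T - 1 := by omega
      refine ⟨Lev.base hθ (hγ _ (by omega)) (hLip _ (by omega)) hsT1b (fun y => ?_) (fun j => ?_), hIbarT1.le⟩
      · rw [hV _ (by omega), hHT1, hHT1, hST1]
      · rw [hphibT1]
    | succ d ih =>
      intro t ht
      obtain ⟨L, hIs⟩ := ih (t + 1) (by omega)
      have ht2 : t + 2 ≤ T := by omega
      have htT : t < T := by omega
      haveI := hprob t
      have hHi : ∀ y, H t y = C t y + α * ∫ ξ, V (t + 1) (y - rr θ ξ * θ) ∂(ν t) := fun y => by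
        rw [hHrec t ht2, L.tsumV (hpos t) hθ (f t) (hf' t)]
      have hPi := fun j : ℤ => L.psi (hpos t) hθ (f t) (hf' t) j (psib t θ (j * θ)) α (γ t)
        (fun h => hpsibA t ht2 θ _ h) (fun h n h1 h2 => by
          rw [hpsibB t ht2 θ _ h n h1 h2]
          push_cast
          simp only [sub_mul])
      obtain ⟨⟨mS, hmS⟩, hIS, hSSU, hSmin⟩ := (hSdef t ht2).1
      obtain ⟨⟨mI, hmI⟩, hIlt⟩ := (hI t ht2).1
      obtain ⟨⟨mB, hmB⟩, hBI, hBC⟩ := (hIbar t ht2).1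
      have hK := hK0 t htT
      have hIb : Ibar t ≤ I t := by
        have hne : mB ≠ mI := by
          rintro rfl
          rw [hmB, hmI] at hBC; linarith
        have hle : mB ≤ mI := by apply int_le hθ; rw [← hmB, ← hmI]; exact hBI
        have : mB + 1 ≤ mI := by omega
        have : (mB : ℝ) + 1 ≤ mI := by exact_mod_cast this
        nlinarith
      have hSK : ∃ σ : ℤ, s t = σ * θ ∧ Ibar t ≤ s t ∧ H t (s t) ≤ H t (S t) + K t ∧
          (H t (S t) + K t ≤ H t (((σ : ℝ) - 1) * θ) ∨ H t (S t) + K t = H t (s t)) := by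
        rcases eq_or_lt_of_le hK with h0 | h0
        · have e := hsdef0 t ht2 h0.symm
          refine ⟨mS, by rw [e, hmS], by rw [e]; linarith, by rw [e]; linarith, Or.inr (by rw [e, ← h0, add_zero])⟩
        · obtain ⟨⟨⟨σ, hσ⟩, h1, h2, h3⟩, hleast⟩ := hsdef1 t ht2 h0
          refine ⟨σ, hσ, h1, h3, Or.inl ?_⟩
          have e1 : ((σ : ℝ) - 1) * θ = s t - θ := by rw [hσ]; ring
          rw [e1]
          rcases eq_or_lt_of_le h1 with h4 | h4
          · rw [← h4]
            have hlt := lt_of_lt_of_le hIlt (min_le_left _ _)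
            obtain ⟨c, hc⟩ := L.const
            have hcc : ∀ y, y ≤ I t → H t y = C t y + α * c := fun y hy => by
              rw [hHi]
              congr 2
              have : ∫ ξ, V (t + 1) (y - rr θ ξ * θ) ∂(ν t) = ∫ _, c ∂(ν t) := by
                apply integral_congr_ae
                filter_upwards [ae_nonneg' (hpos t)] with ξ hξ
                apply hc
                have : (-1 : ℝ) ≤ rr θ ξ := by exact_mod_cast rr_lo hθ hξ
                nlinarith
              rw [this]; simp
            have hS' := hSmin (I t) ⟨mI, hmI⟩ le_rfl (hIS.trans hSSU)
            rw [hcc _ le_rfl] at hS'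
            rw [hcc _ hBI]
            linarith
          · by_contra hcon
            push Not at hcon
            have hle : Ibar t ≤ s t - θ := by
              have e2 : Ibar t = ((mB + 1 : ℤ) : ℝ) * θ := by push_cast; linarith
              have : mB + 1 < σ := by apply int_lt hθ; rw [← e2, ← hσ]; exact h4
              have : ((mB + 1 : ℤ) : ℝ) ≤ (σ : ℝ) - 1 := by
                have : mB + 1 ≤ σ - 1 := by omega
                exact_mod_cast this
              rw [e2, ← e1]; nlinarith
            have := hleast ⟨⟨σ - 1, by rw [← e1]; push_cast; ring⟩, hle, by linarith, hcon.le⟩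
            linarith
      obtain ⟨σ, hσ, hIbs, hj0, hj1⟩ := hSK
      refine ⟨?_, hIbs⟩
      rw [hσ] at hj0 hj1 ⊢
      refine L.step (hpos t) hθ hα0 (hγ t htT) (hLip t htT) hHi hPi (fun y => by rw [hV t htT, hσ]) (fun j => ?_) hj0 hj1
      rw [hphib t ht2, hσ]
      by_cases h : j < σ
      · rw [if_pos h, if_pos (by have : (j : ℝ) < σ := by exact_mod_cast h
                                 nlinarith)]
      · have h' : (σ : ℝ) ≤ j := by exact_mod_cast not_lt.1 h
        rw [if_neg h, if_neg (by nlinarith)]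
        by_cases h2 : (j : ℝ) * θ - θ < σ * θ
        · have : j - 1 < σ := by apply int_lt hθ; push_cast; linarith
          obtain rfl : j = σ := by omega
          rw [if_pos h2, sub_self, zero_add]
        · rw [if_neg h2]
  have lev : ∀ t, t + 1 ≤ T → Lev θ (s t) (V t) (fun j : ℤ => phib t θ (j * θ)) :=
    fun t ht => (main (T - 1 - t) t (by omega)).1
  have psi : ∀ t, t + 2 ≤ T → ∀ j : ℤ, psib t θ (j * θ) - γ t * θ
      = α * ∫ ξ, phib (t + 1) θ (((j - rr θ ξ : ℤ) : ℝ) * θ) ∂(ν t) := fun t ht j => by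
    haveI := hprob t
    have := (lev (t+1) ht).psi (hpos t) hθ (f t) (hf' t) j (psib t θ (j * θ)) α (γ t)
      (fun h => hpsibA t ht θ _ h) (fun h n h1 h2 => by
        rw [hpsibB t ht θ _ h n h1 h2]
        push_cast
        simp only [sub_mul])
    rw [this]; ring
  have hAi : ∀ t, t + 2 ≤ T → ∀ x, A (t + 1) x = (∫ ξ, V (t + 1) (x - ξ) ∂(ν t))
      - ∫ ξ, V (t + 1) (x - rr θ ξ * θ) ∂(ν t) := fun t ht x => by
    haveI := hprob t
    rw [hA (t + 1) (by omega) (by omega), Nat.add_sub_cancel,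
      (lev (t+1) ht).tsumV (hpos t) hθ (f t) (hf' t)]
  have fin : ∀ d t, t + d + 2 = T → ∀ k : ℤ, 0 ≤ epsb t k ∧ ∀ x, x ≤ k * θ → eps t x ≤ epsb t k := by
    intro d
    induction d with
    | zero =>
      intro t ht k
      obtain rfl : t = T - 2 := by omega
      have e1 : T - 2 + 1 = T - 1 := by omega
      have g0 := hγ (T - 1) (by omega)
      rw [hepsbT2]
      refine ⟨by positivity, fun x _ => ?_⟩
      have hA' : ∀ x, A (T - 2 + 1) x ≤ γ (T - 1) * θ := fun x => by
        haveI := hprob (T - 2)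
        rw [hAi (T - 2) (by omega)]
        refine (lev (T - 2 + 1) (by omega)).A1 (hpos _) hθ (fun v u h1 h2 => ?_)
        rw [e1, hV _ (by omega), hV _ (by omega), hHT1, hHT1, hHT1, hST1, ← hsT1b]
        have hl : ∀ a b, b - θ ≤ a → a ≤ b → C (T - 1) a - C (T - 1) b ≤ γ (T - 1) * θ := fun a b h3 h4 => by
          refine ((le_abs_self _).trans (hLip (T - 1) (by omega) a b)).trans (mul_le_mul_of_nonneg_left ?_ g0)
          rw [abs_sub_comm, abs_of_nonneg (by linarith)]; linarith
        have := mul_nonneg g0 hθ.le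
        split_ifs with h3 h4 h4
        · linarith
        · exact hl _ _ (by linarith) (by linarith)
        · linarith
        · exact hl _ _ (by linarith) (by linarith)
      rw [heps _ (by omega), e1]
      simp only [hepsT1, integral_zero, mul_zero, add_zero]
      rw [e1] at hA'
      rw [mul_assoc]
      split_ifs <;> exact mul_le_mul_of_nonneg_left (hA' _) hα0.le
    | succ d ih =>
      intro t ht k
      have ht2 : t + 2 ≤ T := by omega
      haveI := hprob t
      have L := lev (t + 1) (by omega)
      obtain ⟨mS, hmS⟩ := (hSdef t ht2).1.1
      obtain ⟨m, hm⟩ : ∃ m : ℤ, max ((k : ℝ) * θ) (S t) = m * θ := by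
        rcases max_choice ((k : ℝ) * θ) (S t) with h | h
        · exact ⟨k, h⟩
        · exact ⟨mS, by rw [h, hmS]⟩
      obtain ⟨ih0, ih1⟩ := ih (t + 1) (by omega) (m + 1)
      have hl : ∀ i, lam t k (i + 1) = lam (t + 1) (m + 1) i := by
        intro i
        induction i with
        | zero => rw [hlamS, hlam0, hlam0, Nat.add_zero, hm]; push_cast; ring
        | succ i ih => rw [hlamS, ih, hlamS, show t + (i + 1) = t + 1 + i by omega]
      have hform : ∀ t k, t + 2 ≤ T → epsb t k =
          α ^ (T - 1 - t) * γ (T - 1) * θ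
          + ∑ i ∈ Finset.range (T - 2 - t),
            2 * α ^ i * (psib (t + i) θ (max (lam t k i) (S (t + i))) - γ (t + i) * θ) := fun t k ht => by
        rcases Nat.lt_or_ge T (t + 3) with h | h
        · obtain rfl : t = T - 2 := by omega
          rw [hepsbT2, show T - 1 - (T - 2) = 1 by omega]; simp
        · exact hepsbRec t k h
      have hrec : epsb t k = 2 * (psib t θ (m * θ) - γ t * θ) + α * epsb (t + 1) (m + 1) := by
        rw [hform t k ht2, hform (t + 1) (m + 1) (by omega),
          show T - 2 - t = (T - 2 - (t + 1)) + 1 by omega, Finset.sum_range_succ',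
          show T - 1 - t = (T - 1 - (t + 1)) + 1 by omega, hlam0, show t + 0 = t from rfl, hm, mul_add, Finset.mul_sum]
        have : ∀ i ∈ Finset.range (T - 2 - (t + 1)),
            2 * α ^ (i + 1) * (psib (t + (i + 1)) θ (max (lam t k (i + 1)) (S (t + (i + 1)))) - γ (t + (i + 1)) * θ)
            = α * (2 * α ^ i * (psib (t + 1 + i) θ (max (lam (t + 1) (m + 1) i) (S (t + 1 + i))) - γ (t + 1 + i) * θ)) := by
          intro i _
          rw [hl, show t + (i + 1) = t + 1 + i by omega]; ring
        rw [Finset.sum_congr rfl this]; ring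
      rw [psi t ht2] at hrec
      have hnn : 0 ≤ ∫ ξ, phib (t + 1) θ (((m - rr θ ξ : ℤ) : ℝ) * θ) ∂(ν t) :=
        integral_nonneg fun ξ => L.nn _
      refine ⟨by rw [hrec]; positivity, fun x hx => ?_⟩
      have key : ∀ x', x' ≤ m * θ →
          α * A (t + 1) x' + α * ∫ ξ, eps (t + 1) (x' - ξ) ∂(ν t) ≤ epsb t k := fun x' hx' => by
        have a1 := L.A (hpos t) hθ hx'
        rw [← hAi t ht2] at a1
        have a2 : ∫ ξ, eps (t + 1) (x' - ξ) ∂(ν t) ≤ epsb (t + 1) (m + 1) := by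
          by_cases hi : Integrable (fun ξ => eps (t + 1) (x' - ξ)) (ν t)
          · have e : epsb (t + 1) (m + 1) = ∫ _, epsb (t + 1) (m + 1) ∂(ν t) := by simp
            rw [e]
            refine integral_mono_ae hi (integrable_const _) ?_
            filter_upwards [ae_nonneg' (hpos t)] with ξ hξ
            apply ih1; push_cast; linarith
          · rw [integral_undef hi]; exact ih0
        rw [hrec]
        nlinarith
      rw [heps t ht2]
      split_ifs
      · exact key _ (hm ▸ le_max_right _ _)
      · exact key _ (hx.trans (hm ▸ le_max_left _ _))
  intro t ht k x _ hx
  exact (fin (T - 2 - t) t (by omega) k).2 x hx
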